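/- arXiv:1310.6576 — 11 statements merged into one kernel-verified Lean document; each statement's English description precedes it below -/
import Mathlib

section
/- Let α > 0 and μ ≥ 0. Then the operator Y_{α,μ} : Q×V → Q×V defined by Y_{α,μ}(q,u) = T*T(q,u) + (α q, μ u) is boundedly invertible, i.e., it is a continuous linear bijection whose inverse is continuous. -/
/-- For α > 0 and μ ≥ 0 the operator
`Y_{α,μ}(q,u) = T*T(q,u) + (α q, μ u)` on the product Hilbert space `Q × V`
is boundedly invertible: it has a continuous linear two-sided inverse. -/
theorem stmt0
    {Q V G X : Type*}
    [NormedAddCommGroup Q] [InnerProductSpace ℝ Q] [CompleteSpace Q]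
    [NormedAddCommGroup V] [InnerProductSpace ℝ V] [CompleteSpace V]
    [NormedAddCommGroup G] [InnerProductSpace ℝ G] [CompleteSpace G]
    [NormedAddCommGroup X] [InnerProductSpace ℝ X] [CompleteSpace X]
    (C' : V →L[ℝ] G) (L : Q →L[ℝ] X) (K : V →L[ℝ] X)
    (Kinv : X →L[ℝ] V)
    (hK₁ : ∀ v, Kinv (K v) = v) (hK₂ : ∀ x, K (Kinv x) = x)
    (T : WithLp 2 (Q × V) →L[ℝ] WithLp 2 (G × X))
    (hT : ∀ (q : Q) (u : V),
      WithLp.equiv 2 (G × X) (T ((WithLp.equiv 2 (Q × V)).symm (q, u))) = (C' u, L q + K u))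
    (α μ : ℝ) (hα : 0 < α) (hμ : 0 ≤ μ)
    (Y : WithLp 2 (Q × V) →L[ℝ] WithLp 2 (Q × V))
    (hY : ∀ x : WithLp 2 (Q × V),
      Y x = T.adjoint (T x)
        + (WithLp.equiv 2 (Q × V)).symm
            (α • (WithLp.equiv 2 (Q × V) x).1, μ • (WithLp.equiv 2 (Q × V) x).2)) :
    ∃ Yinv : WithLp 2 (Q × V) →L[ℝ] WithLp 2 (Q × V),
      (∀ x, Yinv (Y x) = x) ∧ (∀ x, Y (Yinv x) = x) := by
  have hcoer : IsCoercive ((innerSL ℝ).comp Y) := by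
    set M : ℝ := 2 * ‖Kinv‖ ^ 2 with hM
    set N : ℝ := ‖L‖ ^ 2 with hN
    have hM0 : 0 ≤ M := by positivity
    have hN0 : 0 ≤ N := by positivity
    have hD : 0 < 1 + M * N + M * α := by positivity
    refine ⟨α / (1 + M * N + M * α), by positivity, fun x => ?_⟩
    have hTx : (T x).snd = L x.fst + K x.snd := congrArg Prod.snd (hT x.fst x.snd)
    have hu : ‖x.snd‖ ^ 2 ≤ M * (‖T x‖ ^ 2 + N * ‖x.fst‖ ^ 2) := by
      have h1 : ‖x.snd‖ ≤ ‖Kinv‖ * (‖T x‖ + ‖L‖ * ‖x.fst‖) := by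
        calc ‖x.snd‖ = ‖Kinv ((T x).snd - L x.fst)‖ := by
              rw [hTx, add_sub_cancel_left, hK₁]
          _ ≤ ‖Kinv‖ * ‖(T x).snd - L x.fst‖ := Kinv.le_opNorm _
          _ ≤ ‖Kinv‖ * (‖T x‖ + ‖L‖ * ‖x.fst‖) := by
              gcongr
              exact (norm_sub_le _ _).trans
                (add_le_add (WithLp.norm_snd_le _ _) (L.le_opNorm _))
      calc ‖x.snd‖ ^ 2 ≤ (‖Kinv‖ * (‖T x‖ + ‖L‖ * ‖x.fst‖)) ^ 2 := by gcongr
        _ = ‖Kinv‖ ^ 2 * (‖T x‖ + ‖L‖ * ‖x.fst‖) ^ 2 := mul_pow _ _ _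
        _ ≤ ‖Kinv‖ ^ 2 * (2 * (‖T x‖ ^ 2 + (‖L‖ * ‖x.fst‖) ^ 2)) := by
            gcongr
            exact add_sq_le
        _ = M * (‖T x‖ ^ 2 + N * ‖x.fst‖ ^ 2) := by rw [hM, hN]; ring
    have hx : ‖x‖ ^ 2 = ‖x.fst‖ ^ 2 + ‖x.snd‖ ^ 2 := WithLp.prod_norm_sq_eq_of_L2 x
    have hYx : inner ℝ (Y x) x = ‖T x‖ ^ 2 + (α * ‖x.fst‖ ^ 2 + μ * ‖x.snd‖ ^ 2) := by
      rw [hY, inner_add_left, ContinuousLinearMap.adjoint_inner_left,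
        real_inner_self_eq_norm_sq, WithLp.prod_inner_apply]
      simp [real_inner_smul_left]
    change _ ≤ inner ℝ (Y x) x
    rw [hYx, mul_assoc, ← pow_two, hx, div_mul_eq_mul_div, div_le_iff₀ hD]
    have h2 := mul_le_mul_of_nonneg_left hu hα.le
    have h3 : 0 ≤ μ * ‖x.snd‖ ^ 2 * (1 + M * N + M * α) := by positivity
    have h4 : 0 ≤ (1 + M * N) * ‖T x‖ ^ 2 := by positivity
    have h5 : 0 ≤ M * α * (α * ‖x.fst‖ ^ 2) := by positivity
    linarith
  let e := hcoer.continuousLinearEquivOfBilin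
  have he : ∀ x, e x = Y x := fun x =>
    ext_inner_right ℝ fun y => hcoer.continuousLinearEquivOfBilin_apply x y
  refine ⟨e.symm, fun x => ?_, fun x => ?_⟩
  · rw [← he]
    exact e.symm_apply_apply x
  · rw [← he]
    exact e.apply_symm_apply x
end

section
/- Let α > 0 and μ ≥ 0, and let Y_{α,μ}^{-1} be the inverse of Y_{α,μ}. Then its operator norm on Q×V satisfies ‖Y_{α,μ}^{-1}‖² ≤ (2/α²)·(1 + ‖L‖²·‖K‖²·‖K^{-1}‖⁴)² + 2‖K^{-1}‖⁴. In particular, for every α ∈ (0,1] and μ ≥ 0 one has ‖Y_{α,μ}^{-1}‖ ≤ c_T (1/α + 1) for a constant c_T depending only on ‖L‖, ‖K‖ and ‖K^{-1}‖ (and not on α, μ). -/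
/-- A bounded operator with inverse `Kinv` satisfies `‖Kinv‖ ≤ ‖K‖ * ‖Kinv‖ ^ 2`, also on the
trivial space. -/
lemma norm_rightInverse_le_mul_sq {V X : Type*}
    [NormedAddCommGroup V] [NormedSpace ℝ V] [NormedAddCommGroup X] [NormedSpace ℝ X]
    (K : V →L[ℝ] X) (Kinv : X →L[ℝ] V) (hK : ∀ x, K (Kinv x) = x) :
    ‖Kinv‖ ≤ ‖K‖ * ‖Kinv‖ ^ 2 := by
  refine Kinv.opNorm_le_bound (by positivity) fun x => ?_
  calc ‖Kinv x‖ = ‖Kinv (K (Kinv x))‖ := by rw [hK]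
    _ ≤ ‖Kinv‖ * (‖K‖ * (‖Kinv‖ * ‖x‖)) :=
        Kinv.le_opNorm_of_le (K.le_opNorm_of_le (Kinv.le_opNorm x))
    _ = ‖K‖ * ‖Kinv‖ ^ 2 * ‖x‖ := by ring

/-- The squared norm of `(q, u)` is controlled by the energy `α ‖q‖² + ‖L q + K u‖²`. -/
lemma norm_sq_add_norm_sq_le_energy {Q V X : Type*}
    [NormedAddCommGroup Q] [NormedSpace ℝ Q] [NormedAddCommGroup V] [NormedSpace ℝ V]
    [NormedAddCommGroup X] [NormedSpace ℝ X]
    (L : Q →L[ℝ] X) (K : V →L[ℝ] X) (Kinv : X →L[ℝ] V)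
    (hK₁ : ∀ v, Kinv (K v) = v) (hK₂ : ∀ x, K (Kinv x) = x) {α : ℝ} (hα : 0 < α)
    (q : Q) (u : V) :
    ‖q‖ ^ 2 + ‖u‖ ^ 2 ≤
      ((1 + ‖L‖ ^ 2 * ‖K‖ ^ 2 * ‖Kinv‖ ^ 4) / α + ‖Kinv‖ ^ 2) *
        (α * ‖q‖ ^ 2 + ‖L q + K u‖ ^ 2) := by
  have hu : ‖u‖ ≤ ‖Kinv‖ * (‖L q + K u‖ + ‖L‖ * ‖q‖) := by
    calc ‖u‖ = ‖Kinv ((L q + K u) - L q)‖ := by rw [add_sub_cancel_left, hK₁]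
      _ ≤ ‖Kinv‖ * (‖L q + K u‖ + ‖L‖ * ‖q‖) :=
        Kinv.le_opNorm_of_le ((norm_sub_le _ _).trans (by gcongr; exact L.le_opNorm q))
  have hk : ‖Kinv‖ ^ 2 ≤ ‖K‖ ^ 2 * ‖Kinv‖ ^ 4 := by
    calc ‖Kinv‖ ^ 2 ≤ (‖K‖ * ‖Kinv‖ ^ 2) ^ 2 := by
          gcongr; exact norm_rightInverse_le_mul_sq K Kinv hK₂
      _ = _ := by ring
  set p := ‖q‖
  set w := ‖L q + K u‖
  set l := ‖L‖
  set κ := ‖Kinv‖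
  have hcs : (w + l * p) ^ 2 ≤ (1 + l ^ 2 / α) * (α * p ^ 2 + w ^ 2) := by
    have : (1 + l ^ 2 / α) * (α * p ^ 2 + w ^ 2) - (w + l * p) ^ 2
        = (α * p - l * w) ^ 2 / α := by
      field_simp
      ring
    have : 0 ≤ (α * p - l * w) ^ 2 / α := by positivity
    linarith
  have hp : p ^ 2 ≤ 1 / α * (α * p ^ 2 + w ^ 2) := by
    have : 1 / α * (α * p ^ 2 + w ^ 2) = p ^ 2 + w ^ 2 / α := by field_simp
    have : 0 ≤ w ^ 2 / α := by positivity
    linarith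
  calc p ^ 2 + ‖u‖ ^ 2 ≤ p ^ 2 + (κ * (w + l * p)) ^ 2 := by gcongr
    _ = p ^ 2 + κ ^ 2 * (w + l * p) ^ 2 := by ring
    _ ≤ 1 / α * (α * p ^ 2 + w ^ 2)
        + κ ^ 2 * ((1 + l ^ 2 / α) * (α * p ^ 2 + w ^ 2)) := by gcongr
    _ = ((1 + l ^ 2 * κ ^ 2) / α + κ ^ 2) * (α * p ^ 2 + w ^ 2) := by ring
    _ ≤ ((1 + l ^ 2 * (‖K‖ ^ 2 * κ ^ 4)) / α + κ ^ 2) * (α * p ^ 2 + w ^ 2) := by gcongr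
    _ = _ := by ring

/-- If `‖x‖² ≤ B ⟪Y x, x⟫` for all `x`, every right inverse of `Y` has norm at most `B`. -/
lemma norm_rightInverse_le_of_coercive {H : Type*} [NormedAddCommGroup H] [InnerProductSpace ℝ H]
    (Y Yinv : H →L[ℝ] H) {B : ℝ} (hB : 0 ≤ B) (h : ∀ x, ‖x‖ ^ 2 ≤ B * inner ℝ (Y x) x)
    (hYinv : ∀ x, Y (Yinv x) = x) : ‖Yinv‖ ≤ B := by
  refine Yinv.opNorm_le_bound hB fun z => ?_
  rcases (norm_nonneg (Yinv z)).eq_or_lt with h0 | h0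
  · rw [← h0]
    positivity
  · have h1 := h (Yinv z)
    rw [hYinv] at h1
    have h2 : B * inner ℝ z (Yinv z) ≤ B * (‖z‖ * ‖Yinv z‖) := by
      gcongr
      exact real_inner_le_norm _ _
    refine le_of_mul_le_mul_right ?_ h0
    linarith

/-- The inverse of the regularized normal operator `T* T + diag (α, μ)` has norm at most
`(1 + ‖L‖² ‖K‖² ‖K⁻¹‖⁴) / α + ‖K⁻¹‖²`. -/
lemma norm_regularized_inverse_le
    {Q V G X : Type*}
    [NormedAddCommGroup Q] [InnerProductSpace ℝ Q] [CompleteSpace Q]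
    [NormedAddCommGroup V] [InnerProductSpace ℝ V] [CompleteSpace V]
    [NormedAddCommGroup G] [InnerProductSpace ℝ G] [CompleteSpace G]
    [NormedAddCommGroup X] [InnerProductSpace ℝ X] [CompleteSpace X]
    (C' : V →L[ℝ] G) (L : Q →L[ℝ] X) (K : V →L[ℝ] X) (Kinv : X →L[ℝ] V)
    (hK₁ : ∀ v, Kinv (K v) = v) (hK₂ : ∀ x, K (Kinv x) = x)
    (T : WithLp 2 (Q × V) →L[ℝ] WithLp 2 (G × X))
    (hT : ∀ (q : Q) (u : V),
      WithLp.equiv 2 (G × X) (T ((WithLp.equiv 2 (Q × V)).symm (q, u))) = (C' u, L q + K u))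
    {α μ : ℝ} (hα : 0 < α) (hμ : 0 ≤ μ)
    (Y : WithLp 2 (Q × V) →L[ℝ] WithLp 2 (Q × V))
    (hY : ∀ x : WithLp 2 (Q × V),
      Y x = T.adjoint (T x)
        + (WithLp.equiv 2 (Q × V)).symm
            (α • (WithLp.equiv 2 (Q × V) x).1, μ • (WithLp.equiv 2 (Q × V) x).2))
    (Yinv : WithLp 2 (Q × V) →L[ℝ] WithLp 2 (Q × V)) (hYinv : ∀ x, Y (Yinv x) = x) :
    ‖Yinv‖ ≤ (1 + ‖L‖ ^ 2 * ‖K‖ ^ 2 * ‖Kinv‖ ^ 4) / α + ‖Kinv‖ ^ 2 := by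
  refine norm_rightInverse_le_of_coercive Y Yinv (by positivity) (fun x => ?_) hYinv
  have hTx : (T x).snd = L x.fst + K x.snd := congrArg Prod.snd (hT x.fst x.snd)
  have hinner : inner ℝ (Y x) x = ‖T x‖ ^ 2 + (α * ‖x.fst‖ ^ 2 + μ * ‖x.snd‖ ^ 2) := by
    rw [hY, inner_add_left, ContinuousLinearMap.adjoint_inner_left, real_inner_self_eq_norm_sq,
      WithLp.prod_inner_apply]
    congr 1
    change inner ℝ (α • x.fst) x.fst + inner ℝ (μ • x.snd) x.snd = _
    simp only [real_inner_smul_left, real_inner_self_eq_norm_sq]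
  rw [WithLp.prod_norm_sq_eq_of_L2]
  refine (norm_sq_add_norm_sq_le_energy L K Kinv hK₁ hK₂ hα x.fst x.snd).trans ?_
  gcongr
  rw [hinner, WithLp.prod_norm_sq_eq_of_L2, hTx]
  have h1 : 0 ≤ μ * ‖x.snd‖ ^ 2 := by positivity
  have h2 : 0 ≤ ‖(T x).fst‖ ^ 2 := by positivity
  linarith

/-- For α > 0, μ ≥ 0 and `Yinv` the inverse of `Y_{α,μ}`, one has
`‖Yinv‖² ≤ (2/α²)(1 + ‖L‖²‖K‖²‖K⁻¹‖⁴)² + 2‖K⁻¹‖⁴`; in particular there is a constant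
`c_T > 0` (independent of α, μ) with `‖Y_{α,μ}⁻¹‖ ≤ c_T (1/α + 1)` for all α ∈ (0,1], μ ≥ 0. -/
theorem stmt2
    {Q V G X : Type*}
    [NormedAddCommGroup Q] [InnerProductSpace ℝ Q] [CompleteSpace Q]
    [NormedAddCommGroup V] [InnerProductSpace ℝ V] [CompleteSpace V]
    [NormedAddCommGroup G] [InnerProductSpace ℝ G] [CompleteSpace G]
    [NormedAddCommGroup X] [InnerProductSpace ℝ X] [CompleteSpace X]
    (C' : V →L[ℝ] G) (L : Q →L[ℝ] X) (K : V →L[ℝ] X)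
    (Kinv : X →L[ℝ] V)
    (hK₁ : ∀ v, Kinv (K v) = v) (hK₂ : ∀ x, K (Kinv x) = x)
    (T : WithLp 2 (Q × V) →L[ℝ] WithLp 2 (G × X))
    (hT : ∀ (q : Q) (u : V),
      WithLp.equiv 2 (G × X) (T ((WithLp.equiv 2 (Q × V)).symm (q, u))) = (C' u, L q + K u))
    (α μ : ℝ) (hα : 0 < α) (hμ : 0 ≤ μ)
    (Y : WithLp 2 (Q × V) →L[ℝ] WithLp 2 (Q × V))
    (hY : ∀ x : WithLp 2 (Q × V),
      Y x = T.adjoint (T x)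
        + (WithLp.equiv 2 (Q × V)).symm
            (α • (WithLp.equiv 2 (Q × V) x).1, μ • (WithLp.equiv 2 (Q × V) x).2))
    (Yinv : WithLp 2 (Q × V) →L[ℝ] WithLp 2 (Q × V))
    (hYinv₁ : ∀ x, Yinv (Y x) = x) (hYinv₂ : ∀ x, Y (Yinv x) = x) :
    ‖Yinv‖ ^ 2 ≤ 2 / α ^ 2 * (1 + ‖L‖ ^ 2 * ‖K‖ ^ 2 * ‖Kinv‖ ^ 4) ^ 2 + 2 * ‖Kinv‖ ^ 4
    ∧ ∃ c_T : ℝ, 0 < c_T ∧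
        ∀ (α' μ' : ℝ), 0 < α' → α' ≤ 1 → 0 ≤ μ' →
        ∀ Y' : WithLp 2 (Q × V) →L[ℝ] WithLp 2 (Q × V),
          (∀ x : WithLp 2 (Q × V),
            Y' x = T.adjoint (T x)
              + (WithLp.equiv 2 (Q × V)).symm
                  (α' • (WithLp.equiv 2 (Q × V) x).1, μ' • (WithLp.equiv 2 (Q × V) x).2)) →
        ∀ Yinv' : WithLp 2 (Q × V) →L[ℝ] WithLp 2 (Q × V),
          (∀ x, Yinv' (Y' x) = x) → (∀ x, Y' (Yinv' x) = x) →
          ‖Yinv'‖ ≤ c_T * (1 / α' + 1) := by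
  refine ⟨?_, 1 + ‖L‖ ^ 2 * ‖K‖ ^ 2 * ‖Kinv‖ ^ 4 + ‖Kinv‖ ^ 2, by positivity, ?_⟩
  · have h := norm_regularized_inverse_le C' L K Kinv hK₁ hK₂ T hT hα hμ Y hY Yinv hYinv₂
    set a := 1 + ‖L‖ ^ 2 * ‖K‖ ^ 2 * ‖Kinv‖ ^ 4
    calc ‖Yinv‖ ^ 2 ≤ (a / α + ‖Kinv‖ ^ 2) ^ 2 := by gcongr
      _ ≤ 2 * ((a / α) ^ 2 + (‖Kinv‖ ^ 2) ^ 2) := add_sq_le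
      _ = 2 / α ^ 2 * a ^ 2 + 2 * ‖Kinv‖ ^ 4 := by ring
  · intro α' μ' hα' _ hμ' Y' hY' Yinv' _ hYinv'
    have h := norm_regularized_inverse_le C' L K Kinv hK₁ hK₂ T hT hα' hμ' Y' hY' Yinv' hYinv'
    have ha : 0 ≤ 1 + ‖L‖ ^ 2 * ‖K‖ ^ 2 * ‖Kinv‖ ^ 4 := by positivity
    set a := 1 + ‖L‖ ^ 2 * ‖K‖ ^ 2 * ‖Kinv‖ ^ 4
    have h' : 0 ≤ a + ‖Kinv‖ ^ 2 / α' := by positivity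
    calc ‖Yinv'‖ ≤ a / α' + ‖Kinv‖ ^ 2 := h
      _ ≤ a / α' + ‖Kinv‖ ^ 2 + (a + ‖Kinv‖ ^ 2 / α') := le_add_of_nonneg_right h'
      _ = (a + ‖Kinv‖ ^ 2) * (1 / α' + 1) := by ring
end

section
/- Let α > 0, μ ≥ 0, M := C̃*C̃ + K*K + μ·id_V (which is boundedly invertible since K is), and N := L*L + α·id_Q − L*K M^{-1} K*L : Q → Q. Then ⟨N q, q⟩ ≥ α‖q‖² for all q ∈ Q; consequently N is selfadjoint and boundedly invertible with ‖N^{-1}‖ ≤ 1/α. -/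
open scoped RealInnerProductSpace

/-- If `K* K ≤ M` and `Minv` is a right inverse of `M`, then `K Minv K* ≤ id`. -/
lemma inner_map_rightInverse_adjoint_le {V X : Type*}
    [NormedAddCommGroup V] [InnerProductSpace ℝ V] [CompleteSpace V]
    [NormedAddCommGroup X] [InnerProductSpace ℝ X] [CompleteSpace X]
    (K : V →L[ℝ] X) {M Minv : V →L[ℝ] V} (hM : ∀ v, ‖K v‖ ^ 2 ≤ ⟪M v, v⟫)
    (hMinv : ∀ v, M (Minv v) = v) (x : X) :
    ⟪K (Minv (K.adjoint x)), x⟫ ≤ ‖x‖ ^ 2 := by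
  have h := hM (Minv (K.adjoint x))
  rw [hMinv, ContinuousLinearMap.adjoint_inner_left, real_inner_comm] at h
  have hsq := norm_sub_sq_real (K (Minv (K.adjoint x))) x
  nlinarith [sq_nonneg ‖K (Minv (K.adjoint x)) - x‖]

/-- A right inverse of a selfadjoint operator is selfadjoint. -/
lemma IsSelfAdjoint.of_rightInverse {V : Type*}
    [NormedAddCommGroup V] [InnerProductSpace ℝ V] [CompleteSpace V]
    {M Minv : V →L[ℝ] V} (hM : IsSelfAdjoint M) (hMinv : ∀ v, M (Minv v) = v) :
    IsSelfAdjoint Minv := by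
  rw [ContinuousLinearMap.isSelfAdjoint_iff_isSymmetric] at hM ⊢
  intro v w
  have h := hM (Minv v) (Minv w)
  simp only [ContinuousLinearMap.coe_coe, hMinv] at h ⊢
  exact h.symm

/-- A coercive operator with constant `α` has an inverse of norm at most `1 / α`. -/
lemma exists_inverse_norm_le_of_coercive {Q : Type*}
    [NormedAddCommGroup Q] [InnerProductSpace ℝ Q] [CompleteSpace Q]
    (N : Q →L[ℝ] Q) {α : ℝ} (hα : 0 < α) (hN : ∀ q, α * ‖q‖ ^ 2 ≤ ⟪N q, q⟫) :
    ∃ Ninv : Q →L[ℝ] Q, (∀ q, Ninv (N q) = q) ∧ (∀ q, N (Ninv q) = q) ∧ ‖Ninv‖ ≤ 1 / α := by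
  have hunit : IsUnit N :=
    N.isUnit_of_forall_le_norm_inner_map (c := ⟨α, hα.le⟩) hα fun q ↦ by
      rw [mul_comm]
      exact (hN q).trans (le_abs_self _)
  obtain ⟨u, rfl⟩ := hunit
  have hright (q : Q) : (u : Q →L[ℝ] Q) ((↑u⁻¹ : Q →L[ℝ] Q) q) = q :=
    DFunLike.congr_fun u.mul_inv q
  refine ⟨↑u⁻¹, fun q ↦ DFunLike.congr_fun u.inv_mul q, hright, ?_⟩
  refine ContinuousLinearMap.opNorm_le_bound _ (by positivity) fun q ↦ ?_
  have h := (hN ((↑u⁻¹ : Q →L[ℝ] Q) q)).trans (real_inner_le_norm _ _)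
  rw [hright] at h
  rw [one_div, inv_mul_eq_div, le_div_iff₀ hα]
  rcases (norm_nonneg ((↑u⁻¹ : Q →L[ℝ] Q) q)).eq_or_lt with h0 | h0
  · rw [← h0, zero_mul]
    exact norm_nonneg q
  · nlinarith

/-- For α > 0, μ ≥ 0, `M := C̃*C̃ + K*K + μ·id` (boundedly invertible, with
inverse `Minv`) and `N := L*L + α·id − L*K M⁻¹ K*L`, one has `⟨N q, q⟩ ≥ α‖q‖²` for all q;
consequently N is selfadjoint and boundedly invertible with `‖N⁻¹‖ ≤ 1/α`. -/
theorem stmt4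
    {Q V G X : Type*}
    [NormedAddCommGroup Q] [InnerProductSpace ℝ Q] [CompleteSpace Q]
    [NormedAddCommGroup V] [InnerProductSpace ℝ V] [CompleteSpace V]
    [NormedAddCommGroup G] [InnerProductSpace ℝ G] [CompleteSpace G]
    [NormedAddCommGroup X] [InnerProductSpace ℝ X] [CompleteSpace X]
    (C' : V →L[ℝ] G) (L : Q →L[ℝ] X) (K : V →L[ℝ] X)
    (Kinv : X →L[ℝ] V)
    (hK₁ : ∀ v, Kinv (K v) = v) (hK₂ : ∀ x, K (Kinv x) = x)
    (α μ : ℝ) (hα : 0 < α) (hμ : 0 ≤ μ)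
    (M : V →L[ℝ] V)
    (hM : M = C'.adjoint ∘L C' + K.adjoint ∘L K + μ • ContinuousLinearMap.id ℝ V)
    (Minv : V →L[ℝ] V)
    (hMinv₁ : ∀ v, Minv (M v) = v) (hMinv₂ : ∀ v, M (Minv v) = v)
    (N : Q →L[ℝ] Q)
    (hN : N = L.adjoint ∘L L + α • ContinuousLinearMap.id ℝ Q
        - L.adjoint ∘L K ∘L Minv ∘L K.adjoint ∘L L) :
    (∀ q : Q, α * ‖q‖ ^ 2 ≤ ⟪N q, q⟫)
    ∧ IsSelfAdjoint N
    ∧ ∃ Ninv : Q →L[ℝ] Q, (∀ q, Ninv (N q) = q) ∧ (∀ q, N (Ninv q) = q) ∧ ‖Ninv‖ ≤ 1 / α := by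
  have hMcoer (v : V) : ‖K v‖ ^ 2 ≤ ⟪M v, v⟫ := by
    simp only [hM, add_apply, ContinuousLinearMap.comp_apply,
      smul_apply, ContinuousLinearMap.id_apply, inner_add_left,
      ContinuousLinearMap.adjoint_inner_left, real_inner_smul_left, real_inner_self_eq_norm_sq]
    nlinarith [sq_nonneg ‖C' v‖, mul_nonneg hμ (sq_nonneg ‖v‖)]
  have hMsa : IsSelfAdjoint M := by
    rw [hM, ContinuousLinearMap.isSelfAdjoint_iff_isSymmetric]
    intro v w
    simp [inner_add_left, inner_add_right, ContinuousLinearMap.adjoint_inner_left,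
      ContinuousLinearMap.adjoint_inner_right, real_inner_smul_left, real_inner_smul_right]
  have hMinvSymm := (hMsa.of_rightInverse hMinv₂).isSymmetric
  have hNcoer (q : Q) : α * ‖q‖ ^ 2 ≤ ⟪N q, q⟫ := by
    have h := inner_map_rightInverse_adjoint_le K hMcoer hMinv₂ (L q)
    simp only [hN, sub_apply, add_apply,
      ContinuousLinearMap.comp_apply, smul_apply,
      ContinuousLinearMap.id_apply, inner_sub_left, inner_add_left,
      ContinuousLinearMap.adjoint_inner_left, real_inner_smul_left, real_inner_self_eq_norm_sq]
    linarith
  refine ⟨hNcoer, ?_, exists_inverse_norm_le_of_coercive N hα hNcoer⟩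
  rw [hN, ContinuousLinearMap.isSelfAdjoint_iff_isSymmetric]
  intro p q
  have h := hMinvSymm (K.adjoint (L p)) (K.adjoint (L q))
  simp only [ContinuousLinearMap.coe_coe, ContinuousLinearMap.adjoint_inner_left,
    ContinuousLinearMap.adjoint_inner_right] at h
  simp [inner_add_left, inner_add_right, inner_sub_left, inner_sub_right,
    ContinuousLinearMap.adjoint_inner_left, ContinuousLinearMap.adjoint_inner_right,
    real_inner_smul_left, real_inner_smul_right, h]
end

section
/- Let α > 0, μ ≥ 0, M := C̃*C̃ + K*K + μ·id_V, and N := L*L + α·id_Q − L*K M^{-1} K*L (both boundedly invertible). Define the block operator O : Q×V → Q×V by O(q,u) = ( N^{-1} q − N^{-1} L*K M^{-1} u , −M^{-1} K*L N^{-1} q + (M^{-1} + M^{-1} K*L N^{-1} L*K M^{-1}) u ). Then O ∘ Y_{α,μ} = id and Y_{α,μ} ∘ O = id on Q×V, i.e., O = Y_{α,μ}^{-1}. -/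
/-- The adjoint of the block operator `(q, u) ↦ (C u, L q + K u)` is
`(g, x) ↦ (L* x, C* g + K* x)`. -/
theorem adjoint_block_apply
    {Q V G X : Type*}
    [NormedAddCommGroup Q] [InnerProductSpace ℝ Q] [CompleteSpace Q]
    [NormedAddCommGroup V] [InnerProductSpace ℝ V] [CompleteSpace V]
    [NormedAddCommGroup G] [InnerProductSpace ℝ G] [CompleteSpace G]
    [NormedAddCommGroup X] [InnerProductSpace ℝ X] [CompleteSpace X]
    (C : V →L[ℝ] G) (L : Q →L[ℝ] X) (K : V →L[ℝ] X)
    (T : WithLp 2 (Q × V) →L[ℝ] WithLp 2 (G × X))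
    (hT : ∀ (q : Q) (u : V), T (WithLp.toLp 2 (q, u)) = WithLp.toLp 2 (C u, L q + K u))
    (g : G) (x : X) :
    T.adjoint (WithLp.toLp 2 (g, x)) =
      WithLp.toLp 2 (L.adjoint x, C.adjoint g + K.adjoint x) := by
  refine ext_inner_left ℝ fun w => ?_
  obtain ⟨q, u⟩ := w
  rw [ContinuousLinearMap.adjoint_inner_right, hT]
  simp only [WithLp.prod_inner_apply, inner_add_left, inner_add_right,
    ContinuousLinearMap.adjoint_inner_right]
  ring


/-- With `M`, `N` as before (inverses `Minv`, `Ninv`), the block operator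
`O(q,u) = (N⁻¹ q − N⁻¹L*KM⁻¹ u, −M⁻¹K*LN⁻¹ q + (M⁻¹ + M⁻¹K*LN⁻¹L*KM⁻¹) u)` is a two-sided
inverse of `Y_{α,μ}`. -/
theorem stmt6
    {Q V G X : Type*}
    [NormedAddCommGroup Q] [InnerProductSpace ℝ Q] [CompleteSpace Q]
    [NormedAddCommGroup V] [InnerProductSpace ℝ V] [CompleteSpace V]
    [NormedAddCommGroup G] [InnerProductSpace ℝ G] [CompleteSpace G]
    [NormedAddCommGroup X] [InnerProductSpace ℝ X] [CompleteSpace X]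
    (C' : V →L[ℝ] G) (L : Q →L[ℝ] X) (K : V →L[ℝ] X)
    (Kinv : X →L[ℝ] V)
    (hK₁ : ∀ v, Kinv (K v) = v) (hK₂ : ∀ x, K (Kinv x) = x)
    (α μ : ℝ) (hα : 0 < α) (hμ : 0 ≤ μ)
    (T : WithLp 2 (Q × V) →L[ℝ] WithLp 2 (G × X))
    (hT : ∀ (q : Q) (u : V),
      WithLp.equiv 2 (G × X) (T ((WithLp.equiv 2 (Q × V)).symm (q, u))) = (C' u, L q + K u))
    (Y : WithLp 2 (Q × V) →L[ℝ] WithLp 2 (Q × V))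
    (hY : ∀ x : WithLp 2 (Q × V),
      Y x = T.adjoint (T x)
        + (WithLp.equiv 2 (Q × V)).symm
            (α • (WithLp.equiv 2 (Q × V) x).1, μ • (WithLp.equiv 2 (Q × V) x).2))
    (M : V →L[ℝ] V)
    (hM : M = C'.adjoint ∘L C' + K.adjoint ∘L K + μ • ContinuousLinearMap.id ℝ V)
    (Minv : V →L[ℝ] V)
    (hMinv₁ : ∀ v, Minv (M v) = v) (hMinv₂ : ∀ v, M (Minv v) = v)
    (N : Q →L[ℝ] Q)
    (hN : N = L.adjoint ∘L L + α • ContinuousLinearMap.id ℝ Q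
        - L.adjoint ∘L K ∘L Minv ∘L K.adjoint ∘L L)
    (Ninv : Q →L[ℝ] Q)
    (hNinv₁ : ∀ q, Ninv (N q) = q) (hNinv₂ : ∀ q, N (Ninv q) = q)
    (O : WithLp 2 (Q × V) →L[ℝ] WithLp 2 (Q × V))
    (hO : ∀ (q : Q) (u : V),
      WithLp.equiv 2 (Q × V) (O ((WithLp.equiv 2 (Q × V)).symm (q, u)))
        = (Ninv q - Ninv (L.adjoint (K (Minv u))),
           -Minv (K.adjoint (L (Ninv q)))
             + (Minv u + Minv (K.adjoint (L (Ninv (L.adjoint (K (Minv u))))))))) :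
    (∀ x : WithLp 2 (Q × V), O (Y x) = x) ∧ (∀ x : WithLp 2 (Q × V), Y (O x) = x) := by
  have hT' : ∀ (q : Q) (u : V),
      T (WithLp.toLp 2 (q, u)) = WithLp.toLp 2 (C' u, L q + K u) := fun q u =>
    (WithLp.equiv 2 (G × X)).injective (hT q u)
  have hO' : ∀ (q : Q) (u : V), O (WithLp.toLp 2 (q, u)) =
      WithLp.toLp 2 (Ninv (q - L.adjoint (K (Minv u))),
        Minv u - Minv (K.adjoint (L (Ninv (q - L.adjoint (K (Minv u))))))) := by
    intro q u
    refine (WithLp.equiv 2 (Q × V)).injective ((hO q u).trans ?_)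
    refine Prod.ext ?_ ?_
    · simp
    · simp only [map_sub, WithLp.equiv_apply]
      abel
  have hY' : ∀ (q : Q) (u : V), Y (WithLp.toLp 2 (q, u)) =
      WithLp.toLp 2 (N q + L.adjoint (K (Minv (K.adjoint (L q)) + u)),
        K.adjoint (L q) + M u) := by
    intro q u
    rw [hY, hT', adjoint_block_apply C' L K T hT', hM, hN]
    refine (WithLp.equiv 2 (Q × V)).injective (Prod.ext ?_ ?_)
    · simp
      abel
    · simp
      abel
  refine ⟨?_, ?_⟩
  · rintro ⟨q, u⟩
    rw [hY', hO', map_add Minv, hMinv₁, add_sub_cancel_right, hNinv₁, add_sub_cancel_left]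
  · rintro ⟨q, u⟩
    rw [hO', hY', hNinv₂, add_sub_cancel, sub_add_cancel, map_sub M, hMinv₂, hMinv₂,
      add_sub_cancel]
end

section
/- Let β > 0, q₀, q_old ∈ Q, u₀, u_old ∈ V, r^f ∈ X, r^g ∈ G, and suppose (q, u, p) ∈ Q × V × X satisfies the stationarity system: (a) L(q − q_old) + K(u − u_old) + r^f = 0; (b) K* p = 2 C*(C(u − u_old) + r^g) + (2/β)(u − u₀); (c) L* p = (2/β)(q − q₀). Then ‖K* p‖_V ≤ 2 (1/β + ‖C‖²)^{1/2} · [ ‖r^g‖_G + β^{-1/2} ‖u₀ − u_old‖_V + (1/β + ‖C‖²)^{1/2} ‖K^{-1}( L(q₀ − q_old) + r^f )‖_V ]. -/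
/-- Bound on the adjoint variable: if (q,u,p) satisfies the stationarity
system (a)-(c), then
`‖K*p‖ ≤ 2√(1/β+‖C‖²) (‖r^g‖ + β^{-1/2}‖u₀−u_old‖ + √(1/β+‖C‖²)‖K⁻¹(L(q₀−q_old)+r^f)‖)`. -/
theorem stmt7
    {Q V G X : Type*}
    [NormedAddCommGroup Q] [InnerProductSpace ℝ Q] [CompleteSpace Q]
    [NormedAddCommGroup V] [InnerProductSpace ℝ V] [CompleteSpace V]
    [NormedAddCommGroup G] [InnerProductSpace ℝ G] [CompleteSpace G]
    [NormedAddCommGroup X] [InnerProductSpace ℝ X] [CompleteSpace X]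
    (C : V →L[ℝ] G) (L : Q →L[ℝ] X) (K : V →L[ℝ] X)
    (Kinv : X →L[ℝ] V)
    (hK₁ : ∀ v, Kinv (K v) = v) (hK₂ : ∀ x, K (Kinv x) = x)
    (β : ℝ) (hβ : 0 < β)
    (q₀ qold q : Q) (u₀ uold u : V) (rf : X) (rg : G) (p : X)
    (ha : L (q - qold) + K (u - uold) + rf = 0)
    (hb : K.adjoint p = (2 : ℝ) • C.adjoint (C (u - uold) + rg) + (2 / β) • (u - u₀))
    (hc : L.adjoint p = (2 / β) • (q - q₀)) :
    ‖K.adjoint p‖ ≤ 2 * Real.sqrt (1 / β + ‖C‖ ^ 2) *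
      (‖rg‖ + (Real.sqrt β)⁻¹ * ‖u₀ - uold‖
        + Real.sqrt (1 / β + ‖C‖ ^ 2) * ‖Kinv (L (q₀ - qold) + rf)‖) := by
  obtain ⟨t, ht⟩ : ∃ t, t = (Real.sqrt β)⁻¹ := ⟨_, rfl⟩
  have t_nonneg : 0 ≤ t := by rw [ht]; positivity
  have t_sq : t ^ 2 = 1 / β := by
    rw [ht, inv_pow, Real.sq_sqrt hβ.le, one_div]
  have two_div : 2 / β = 2 * t ^ 2 := by rw [t_sq]; ring
  rw [← ht, ← t_sq]
  rw [two_div] at hb hc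
  clear ht t_sq two_div
  set w := Kinv (L (q₀ - qold) + rf) with hw
  set z₁ := C (u - uold) + rg with hz₁
  set z₂ := t • (u - u₀) with hz₂
  have K_adjoint_p : K.adjoint p = (2 : ℝ) • (C.adjoint z₁ + t • z₂) := by
    rw [hb, hz₂]; module
  have inner_K_adjoint (v : V) :
      inner ℝ (K.adjoint p) v = 2 * (inner ℝ z₁ (C v) + t * inner ℝ z₂ v) := by
    rw [K_adjoint_p, real_inner_smul_left, inner_add_left, real_inner_smul_left,
      ContinuousLinearMap.adjoint_inner_left]
  have inner_nonpos : inner ℝ (K.adjoint p) (u - uold + w) ≤ 0 := by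
    have hK : K (u - uold + w) = -L (q - q₀) := by
      have hL : L (q - qold) = L (q - q₀) + L (q₀ - qold) := by
        rw [← map_add, sub_add_sub_cancel]
      rw [map_add, hw, hK₂, ← sub_eq_zero, ← ha, hL]; abel
    rw [ContinuousLinearMap.adjoint_inner_left, hK, inner_neg_right,
      ← ContinuousLinearMap.adjoint_inner_left, hc, real_inner_smul_left,
      real_inner_self_eq_norm_sq, neg_nonpos]
    positivity
  have energy : ‖z₁‖ ^ 2 + ‖z₂‖ ^ 2 ≤
      ‖z₁‖ * ‖rg‖ + t * (‖z₂‖ * ‖u₀ - uold‖)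
        + (‖C‖ * ‖z₁‖ + t * ‖z₂‖) * ‖w‖ := by
    rw [inner_K_adjoint] at inner_nonpos
    have hC : C (u - uold + w) = z₁ - rg + C w := by rw [map_add, hz₁]; abel
    have hu : t * inner ℝ z₂ (u - uold + w) =
        ‖z₂‖ ^ 2 + t * inner ℝ z₂ (u₀ - uold) + t * inner ℝ z₂ w := by
      have hsplit : u - uold + w = (u - u₀) + (u₀ - uold) + w := by abel
      rw [hsplit, inner_add_right, inner_add_right, mul_add, mul_add,
        ← real_inner_smul_right z₂ (u - u₀), ← hz₂, real_inner_self_eq_norm_sq]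
    rw [hC, hu, inner_add_right, inner_sub_right, real_inner_self_eq_norm_sq] at inner_nonpos
    have h₁ := real_inner_le_norm z₁ rg
    have h₂ := mul_le_mul_of_nonneg_left
      (neg_le_of_abs_le (abs_real_inner_le_norm z₂ (u₀ - uold))) t_nonneg
    have h₃ := mul_le_mul_of_nonneg_left
      (neg_le_of_abs_le (abs_real_inner_le_norm z₂ w)) t_nonneg
    have h₄ := neg_le_of_abs_le (abs_real_inner_le_norm z₁ (C w))
    have h₅ := mul_le_mul_of_nonneg_left (C.le_opNorm w) (norm_nonneg z₁)
    linarith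
  have norm_le : ‖K.adjoint p‖ ≤ 2 * (‖C‖ * ‖z₁‖ + t * ‖z₂‖) := by
    rw [K_adjoint_p, norm_smul, Real.norm_ofNat]
    gcongr
    refine (norm_add_le _ _).trans (add_le_add ?_ ?_)
    · simpa using C.adjoint.le_opNorm z₁
    · rw [norm_smul, Real.norm_of_nonneg t_nonneg]
  set S := Real.sqrt (t ^ 2 + ‖C‖ ^ 2) with hS
  set Z := Real.sqrt (‖z₁‖ ^ 2 + ‖z₂‖ ^ 2) with hZ
  have Z_sq : Z ^ 2 = ‖z₁‖ ^ 2 + ‖z₂‖ ^ 2 := Real.sq_sqrt (by positivity)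
  have S_nonneg : 0 ≤ S := Real.sqrt_nonneg _
  have Z_nonneg : 0 ≤ Z := Real.sqrt_nonneg _
  have cauchy_schwarz : ‖C‖ * ‖z₁‖ + t * ‖z₂‖ ≤ S * Z := by
    rw [hS, hZ, ← Real.sqrt_mul (by positivity)]
    refine Real.le_sqrt_of_sq_le ?_
    nlinarith [sq_nonneg (‖C‖ * ‖z₂‖ - t * ‖z₁‖)]
  have z₁_le : ‖z₁‖ ≤ Z := Real.le_sqrt_of_sq_le (by linarith [sq_nonneg ‖z₂‖])
  have z₂_le : ‖z₂‖ ≤ Z := Real.le_sqrt_of_sq_le (by linarith [sq_nonneg ‖z₁‖])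
  have Z_le : Z ≤ ‖rg‖ + t * ‖u₀ - uold‖ + S * ‖w‖ := by
    have hZZ : Z * Z ≤ Z * (‖rg‖ + t * ‖u₀ - uold‖ + S * ‖w‖) :=
      calc Z * Z = ‖z₁‖ ^ 2 + ‖z₂‖ ^ 2 := by rw [← Z_sq, sq]
        _ ≤ _ := energy
        _ ≤ Z * ‖rg‖ + t * (Z * ‖u₀ - uold‖) + S * Z * ‖w‖ := by gcongr
        _ = _ := by ring
    rcases Z_nonneg.eq_or_lt with h | h
    · rw [← h]; positivity
    · exact le_of_mul_le_mul_left hZZ h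
  calc ‖K.adjoint p‖ ≤ 2 * (‖C‖ * ‖z₁‖ + t * ‖z₂‖) := norm_le
    _ ≤ 2 * (S * Z) := by gcongr
    _ ≤ 2 * (S * (‖rg‖ + t * ‖u₀ - uold‖ + S * ‖w‖)) := by gcongr
    _ = _ := by ring
end

section
/- Let β > 0, q₀, q_old ∈ Q, u₀, u_old ∈ V, r^g ∈ G, r^f ∈ X, and suppose (q, u) ∈ Q × V and p ∈ X satisfy: for all δq ∈ Q and δu ∈ V, ⟨C̃(u − u_old) + r^g, C̃ δu⟩_G + (1/β)(⟨q − q₀, δq⟩_Q + ⟨u − u₀, δu⟩_V) + (1/2)⟨L δq + K δu, p⟩_X = 0, together with the constraint L(q − q_old) + K(u − u_old) + r^f = 0. Then for every (q†, u†) ∈ Q × V: ‖C̃(u − u_old) + r^g‖_G² + (1/β)(‖q − q₀‖_Q² + ‖u − u₀‖_V²) ≤ ‖C̃(u† − u_old) + r^g‖_G² + (1/β)(‖q† − q₀‖_Q² + ‖u† − u₀‖_V²) + ‖L(q† − q_old) + K(u† − u_old) + r^f‖_X · ‖p‖_X. -/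
open scoped RealInnerProductSpace

/-- The tangent at `a` bounds the squared norm from below. -/
theorem norm_sq_add_two_inner_le {E : Type*} [NormedAddCommGroup E] [InnerProductSpace ℝ E]
    (a b : E) : ‖a‖ ^ 2 + 2 * ⟪a, b - a⟫ ≤ ‖b‖ ^ 2 := by
  have h := norm_add_sq_real a (b - a)
  rw [add_sub_cancel] at h
  linarith [sq_nonneg ‖b - a‖]

/-- Minimality-type estimate from the stationarity system of the
constrained Gauss-Newton step. -/
theorem stmt9
    {Q V G X : Type*}
    [NormedAddCommGroup Q] [InnerProductSpace ℝ Q] [CompleteSpace Q]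
    [NormedAddCommGroup V] [InnerProductSpace ℝ V] [CompleteSpace V]
    [NormedAddCommGroup G] [InnerProductSpace ℝ G] [CompleteSpace G]
    [NormedAddCommGroup X] [InnerProductSpace ℝ X] [CompleteSpace X]
    (C' : V →L[ℝ] G) (L : Q →L[ℝ] X) (K : V →L[ℝ] X)
    (β : ℝ) (hβ : 0 < β)
    (q₀ qold q : Q) (u₀ uold u : V) (rg : G) (rf : X) (p : X)
    (hstat : ∀ (δq : Q) (δu : V),
      ⟪C' (u - uold) + rg, C' δu⟫
        + (1 / β) * (⟪q - q₀, δq⟫ + ⟪u - u₀, δu⟫)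
        + (1 / 2) * ⟪L δq + K δu, p⟫ = 0)
    (hconstr : L (q - qold) + K (u - uold) + rf = 0) :
    ∀ (qd : Q) (ud : V),
      ‖C' (u - uold) + rg‖ ^ 2 + (1 / β) * (‖q - q₀‖ ^ 2 + ‖u - u₀‖ ^ 2)
        ≤ ‖C' (ud - uold) + rg‖ ^ 2 + (1 / β) * (‖qd - q₀‖ ^ 2 + ‖ud - u₀‖ ^ 2)
          + ‖L (qd - qold) + K (ud - uold) + rf‖ * ‖p‖ := by
  intro qd ud
  have hG := norm_sq_add_two_inner_le (C' (u - uold) + rg) (C' (ud - uold) + rg)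
  have hQ := norm_sq_add_two_inner_le (q - q₀) (qd - q₀)
  have hV := norm_sq_add_two_inner_le (u - u₀) (ud - u₀)
  rw [show C' (ud - uold) + rg - (C' (u - uold) + rg) = C' (ud - u) by
    simp only [map_sub]; abel] at hG
  rw [sub_sub_sub_cancel_right] at hQ hV
  have hres : L (qd - q) + K (ud - u) = L (qd - qold) + K (ud - uold) + rf := by
    rw [← sub_zero (L (qd - qold) + K (ud - uold) + rf), ← hconstr]
    simp only [map_sub]
    abel
  have hs := hstat (qd - q) (ud - u)
  rw [hres] at hs
  have hp := real_inner_le_norm (L (qd - qold) + K (ud - uold) + rf) p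
  have hQV := mul_le_mul_of_nonneg_left (add_le_add hQ hV) (one_div_pos.mpr hβ).le
  linarith
end

section
/- Let A : Q × V → X and C : V → G be maps, (q_old, u_old), (q†, u†) ∈ Q × V, and let C̃ : V → G, L : Q → X, K : V → X be bounded linear operators satisfying the tangential cone conditions ‖C(u_old) − C(u†) − C̃(u_old − u†)‖_G ≤ c ‖C(u_old) − C(u†)‖_G and ‖A(q_old, u_old) − A(q†, u†) − L(q_old − q†) − K(u_old − u†)‖_X ≤ 4c² ‖A(q_old, u_old) − A(q†, u†)‖_X for some c ≥ 0. Suppose C(u†) = g, A(q†, u†) = f, ‖g − g^δ‖_G ≤ δ, and ϱ ≥ 0. Then ‖C̃(u† − u_old) + C(u_old) − g^δ‖_G² + ϱ ‖L(q† − q_old) + K(u† − u_old) + A(q_old, u_old) − f‖_X ≤ 4c² ( ‖C(u_old) − g^δ‖_G² + ϱ ‖A(q_old, u_old) − f‖_X ) + 2(1 + 2c²) δ². -/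
/-- Tangential-cone estimate for the linearized residual at the exact
solution. -/
theorem stmt10
    {Q V G X : Type*}
    [NormedAddCommGroup Q] [InnerProductSpace ℝ Q] [CompleteSpace Q]
    [NormedAddCommGroup V] [InnerProductSpace ℝ V] [CompleteSpace V]
    [NormedAddCommGroup G] [InnerProductSpace ℝ G] [CompleteSpace G]
    [NormedAddCommGroup X] [InnerProductSpace ℝ X] [CompleteSpace X]
    (A : Q × V → X) (C : V → G)
    (qold qd : Q) (uold ud : V)
    (C' : V →L[ℝ] G) (L : Q →L[ℝ] X) (K : V →L[ℝ] X)
    (c : ℝ) (hc : 0 ≤ c)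
    (htcC : ‖C uold - C ud - C' (uold - ud)‖ ≤ c * ‖C uold - C ud‖)
    (htcA : ‖A (qold, uold) - A (qd, ud) - L (qold - qd) - K (uold - ud)‖
      ≤ 4 * c ^ 2 * ‖A (qold, uold) - A (qd, ud)‖)
    (g gδ : G) (f : X) (δ : ℝ) (hδ : 0 ≤ δ)
    (hCd : C ud = g) (hAd : A (qd, ud) = f)
    (hnoise : ‖g - gδ‖ ≤ δ)
    (ϱ : ℝ) (hϱ : 0 ≤ ϱ) :
    ‖C' (ud - uold) + C uold - gδ‖ ^ 2
        + ϱ * ‖L (qd - qold) + K (ud - uold) + A (qold, uold) - f‖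
      ≤ 4 * c ^ 2 * (‖C uold - gδ‖ ^ 2 + ϱ * ‖A (qold, uold) - f‖)
        + 2 * (1 + 2 * c ^ 2) * δ ^ 2 := by
  subst hCd hAd
  have hA : L (qd - qold) + K (ud - uold) + A (qold, uold) - A (qd, ud)
      = A (qold, uold) - A (qd, ud) - L (qold - qd) - K (uold - ud) := by
    simp only [map_sub]
    abel
  have hC : C' (ud - uold) + C uold - gδ
      = (C uold - C ud - C' (uold - ud)) + (C ud - gδ) := by
    simp only [map_sub]
    abel
  have hdiff : ‖C uold - C ud‖ ≤ ‖C uold - gδ‖ + δ := by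
    have h := norm_sub_le_norm_sub_add_norm_sub (C uold) gδ (C ud)
    rw [norm_sub_rev gδ] at h
    linarith
  have hres : ‖C' (ud - uold) + C uold - gδ‖ ≤ c * (‖C uold - gδ‖ + δ) + δ := by
    rw [hC]
    exact (norm_add_le _ _).trans
      (add_le_add (htcC.trans (mul_le_mul_of_nonneg_left hdiff hc)) hnoise)
  have hsq : ‖C' (ud - uold) + C uold - gδ‖ ^ 2
      ≤ 4 * c ^ 2 * ‖C uold - gδ‖ ^ 2 + 2 * (1 + 2 * c ^ 2) * δ ^ 2 := by
    refine (pow_le_pow_left₀ (norm_nonneg _) hres 2).trans ?_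
    linarith [sq_nonneg (c * (‖C uold - gδ‖ + δ) - δ),
      sq_nonneg (c * (‖C uold - gδ‖ - δ))]
  rw [← hA] at htcA
  linarith [mul_le_mul_of_nonneg_left htcA hϱ]
end

section
/- Let A : Q × V → X and C : V → G be maps, (q_old, u_old), (q, u) ∈ Q × V, and let C̃ : V → G, L : Q → X, K : V → X be bounded linear operators satisfying ‖C(u_old) − C(u) − C̃(u_old − u)‖_G ≤ c ‖C(u_old) − C(u)‖_G and ‖A(q_old, u_old) − A(q, u) − L(q_old − q) − K(u_old − u)‖_X ≤ 4c² ‖A(q_old, u_old) − A(q, u)‖_X for some c ≥ 0 with 4c² < 1. Suppose the linearized constraint L(q − q_old) + K(u − u_old) + A(q_old, u_old) − f = 0 holds and ϱ ≥ 0. Then ‖C(u) − g^δ‖_G² + ϱ ‖A(q, u) − f‖_X ≤ (1/(1 − 4c²)) · ( 2 ‖C̃(u − u_old) + C(u_old) − g^δ‖_G² + 4c² ( ‖C(u_old) − g^δ‖_G² + ϱ ‖A(q_old, u_old) − f‖_X ) ). -/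
/-- Estimate of the nonlinear residual `I₄` in terms of the linearized
residual `I₂` and the old nonlinear residual `I₃`, under the tangential cone conditions and
the linearized constraint. -/
theorem stmt11
    {Q V G X : Type*}
    [NormedAddCommGroup Q] [InnerProductSpace ℝ Q] [CompleteSpace Q]
    [NormedAddCommGroup V] [InnerProductSpace ℝ V] [CompleteSpace V]
    [NormedAddCommGroup G] [InnerProductSpace ℝ G] [CompleteSpace G]
    [NormedAddCommGroup X] [InnerProductSpace ℝ X] [CompleteSpace X]
    (A : Q × V → X) (C : V → G)
    (qold q : Q) (uold u : V)
    (C' : V →L[ℝ] G) (L : Q →L[ℝ] X) (K : V →L[ℝ] X)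
    (c : ℝ) (hc : 0 ≤ c) (hc1 : 4 * c ^ 2 < 1)
    (htcC : ‖C uold - C u - C' (uold - u)‖ ≤ c * ‖C uold - C u‖)
    (htcA : ‖A (qold, uold) - A (q, u) - L (qold - q) - K (uold - u)‖
      ≤ 4 * c ^ 2 * ‖A (qold, uold) - A (q, u)‖)
    (gδ : G) (f : X)
    (hconstr : L (q - qold) + K (u - uold) + A (qold, uold) - f = 0)
    (ϱ : ℝ) (hϱ : 0 ≤ ϱ) :
    ‖C u - gδ‖ ^ 2 + ϱ * ‖A (q, u) - f‖
      ≤ (1 / (1 - 4 * c ^ 2)) *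
          (2 * ‖C' (u - uold) + C uold - gδ‖ ^ 2
            + 4 * c ^ 2 * (‖C uold - gδ‖ ^ 2 + ϱ * ‖A (qold, uold) - f‖)) := by
  have hC : ‖C u - gδ‖ ≤ ‖C' (u - uold) + C uold - gδ‖ + c * (‖C u - gδ‖ + ‖C uold - gδ‖) := by
    have h1 : C u - gδ = (C' (u - uold) + C uold - gδ)
        - (C uold - C u - C' (uold - u)) := by
      simp only [map_sub]; abel
    have h2 : ‖C uold - C u‖ ≤ ‖C u - gδ‖ + ‖C uold - gδ‖ := by
      have h := norm_sub_le (C uold - gδ) (C u - gδ)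
      rw [sub_sub_sub_cancel_right] at h
      linarith
    have h3 := norm_sub_le (C' (u - uold) + C uold - gδ) (C uold - C u - C' (uold - u))
    rw [← h1] at h3
    linarith [mul_le_mul_of_nonneg_left h2 hc]
  have hA : ‖A (q, u) - f‖ ≤ 4 * c ^ 2 * (‖A (q, u) - f‖ + ‖A (qold, uold) - f‖) := by
    have h1 : A (qold, uold) - A (q, u) - L (qold - q) - K (uold - u) = -(A (q, u) - f) := by
      rw [← sub_eq_zero, ← hconstr]
      simp only [map_sub]; abel
    rw [h1, norm_neg] at htcA
    have h2 : ‖A (qold, uold) - A (q, u)‖ ≤ ‖A (q, u) - f‖ + ‖A (qold, uold) - f‖ := by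
      have h := norm_sub_le (A (qold, uold) - f) (A (q, u) - f)
      rw [sub_sub_sub_cancel_right] at h
      linarith
    exact htcA.trans (by gcongr)
  have hsq : ‖C u - gδ‖ ^ 2 ≤ 2 * ‖C' (u - uold) + C uold - gδ‖ ^ 2
      + 4 * c ^ 2 * (‖C u - gδ‖ ^ 2 + ‖C uold - gδ‖ ^ 2) := by
    have h1 := pow_le_pow_left₀ (norm_nonneg _) hC 2
    have h2 := add_sq_le (a := ‖C' (u - uold) + C uold - gδ‖)
      (b := c * (‖C u - gδ‖ + ‖C uold - gδ‖))
    have h3 := mul_le_mul_of_nonneg_left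
      (add_sq_le (a := ‖C u - gδ‖) (b := ‖C uold - gδ‖)) (sq_nonneg c)
    linarith [mul_pow c (‖C u - gδ‖ + ‖C uold - gδ‖) 2]
  rw [one_div, ← div_eq_inv_mul, le_div_iff₀ (by linarith)]
  linarith [mul_le_mul_of_nonneg_left hA hϱ]
end

section
/- Let q₀, q† ∈ Q and u₀, u† ∈ V, and suppose there exist g̃ ∈ G and f̃ ∈ X such that q† − q₀ = L* f̃ and u† − u₀ = C̃* g̃ + K* f̃ (this is the all-at-once source condition (q† − q₀, u† − u₀) = T* (g̃, f̃)). Then, with S' := −K^{-1} ∘ L : Q → V, one has q† − q₀ = (S')* ( C̃* g̃ + u₀ − u† ). -/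
/-- If the all-at-once source condition
`q† − q₀ = L* f̃`, `u† − u₀ = C̃* g̃ + K* f̃` holds, then with `S' := −K⁻¹ ∘ L` one has
`q† − q₀ = (S')* (C̃* g̃ + u₀ − u†)`, i.e. the reduced source condition. -/
theorem stmt14
    {Q V G X : Type*}
    [NormedAddCommGroup Q] [InnerProductSpace ℝ Q] [CompleteSpace Q]
    [NormedAddCommGroup V] [InnerProductSpace ℝ V] [CompleteSpace V]
    [NormedAddCommGroup G] [InnerProductSpace ℝ G] [CompleteSpace G]
    [NormedAddCommGroup X] [InnerProductSpace ℝ X] [CompleteSpace X]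
    (C' : V →L[ℝ] G) (L : Q →L[ℝ] X) (K : V →L[ℝ] X)
    (Kinv : X →L[ℝ] V)
    (hK₁ : ∀ v, Kinv (K v) = v) (hK₂ : ∀ x, K (Kinv x) = x)
    (q₀ qd : Q) (u₀ ud : V) (g' : G) (f' : X)
    (hsource_q : qd - q₀ = L.adjoint f')
    (hsource_u : ud - u₀ = C'.adjoint g' + K.adjoint f') :
    qd - q₀ = (-(Kinv ∘L L)).adjoint (C'.adjoint g' + u₀ - ud) := by
  have hres : C'.adjoint g' + u₀ - ud = -K.adjoint f' := by
    rw [add_sub_assoc, ← neg_sub ud u₀, hsource_u]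
    abel
  rw [hsource_q, hres]
  refine ext_inner_right ℝ fun q => ?_
  simp [ContinuousLinearMap.adjoint_inner_left, hK₂]
end

section
/- For every ν ∈ [0,1] there exists a constant C_ν > 0 (depending only on ν and on T) such that for all α ∈ (0,1] and all μ ∈ [0,α]: α · ‖Y_{α,μ}^{-1} ∘ (T*T)^ν‖ ≤ C_ν α^ν, where (T*T)^ν is defined by continuous functional calculus on the positive selfadjoint operator T*T and the norm is the operator norm on Q×V. -/
open ContinuousLinearMap in
/-- A real star-algebra homomorphism from `C(S, ℝ)` to operators on a real Hilbert space is
contractive. -/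
theorem norm_starAlgHom_apply_le_of_abs_le {S H : Type*} [TopologicalSpace S]
    [NormedAddCommGroup H] [InnerProductSpace ℝ H] [CompleteSpace H]
    (Φ : C(S, ℝ) →⋆ₐ[ℝ] (H →L[ℝ] H)) (g : C(S, ℝ)) {c : ℝ} (hc : 0 ≤ c)
    (hg : ∀ s, |g s| ≤ c) (x : H) : ‖Φ g x‖ ≤ c * ‖x‖ := by
  have norm_sq (f : C(S, ℝ)) : ‖Φ f x‖ ^ 2 = inner ℝ (Φ (f * f) x) x := by
    have hstar : star f = f := by ext s; simp
    have h : Φ (f * f) = adjoint (Φ f) ∘L Φ f := by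
      rw [map_mul, ← star_eq_adjoint, ← map_star, hstar]
      rfl
    rw [h, comp_apply, adjoint_inner_left, real_inner_self_eq_norm_sq]
  let h : C(S, ℝ) := ⟨fun s => Real.sqrt (c ^ 2 - g s ^ 2), by fun_prop⟩
  have hh : h * h = c ^ 2 • (1 : C(S, ℝ)) - g * g := by
    ext s
    have h2 : g s ^ 2 ≤ c ^ 2 := sq_le_sq' (abs_le.mp (hg s)).1 (abs_le.mp (hg s)).2
    have h3 := Real.mul_self_sqrt (sub_nonneg.mpr h2)
    simp only [h, ContinuousMap.mul_apply, ContinuousMap.coe_mk, ContinuousMap.sub_apply,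
      ContinuousMap.smul_apply, ContinuousMap.one_apply, smul_eq_mul, mul_one]
    rw [h3]
    ring
  have key := norm_sq h
  rw [hh, map_sub, map_smul, map_one, sub_apply, inner_sub_left, ← norm_sq g,
    smul_apply, one_apply_eq_self, real_inner_smul_left,
    real_inner_self_eq_norm_sq] at key
  refine (sq_le_sq₀ (norm_nonneg _) (by positivity)).1 ?_
  nlinarith [sq_nonneg ‖Φ h x‖]

theorem starAlgHom_apply_eq_add_smul_one_mul {A B : Type*} [Ring A] [StarRing A] [Algebra ℝ A]
    [Ring B] [StarRing B] [Algebra ℝ B] (Φ : A →⋆ₐ[ℝ] B) {e f g : A} {b : B} {α : ℝ}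
    (hb : Φ e = b) (h : f = (e + α • 1) * g) : Φ f = (b + α • 1) * Φ g := by
  rw [h, map_mul, map_add, map_smul, map_one, hb]

theorem Real.rpow_div_add_le_rpow_sub_one {x α ν : ℝ} (hx : 0 ≤ x) (hα : 0 < α)
    (h0 : 0 ≤ ν) (h1 : ν ≤ 1) : x ^ ν / (x + α) ≤ α ^ (ν - 1) := by
  rw [div_le_iff₀ (by positivity)]
  have h := Real.geom_mean_le_arith_mean2_weighted h0 (sub_nonneg.mpr h1) hx hα.le (by ring)
  have hpos : 0 < α ^ (1 - ν) := Real.rpow_pos_of_pos hα _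
  have hinv : α ^ (ν - 1) * α ^ (1 - ν) = 1 := by
    rw [← Real.rpow_add hα]; simp
  have hle : x ^ ν * α ^ (1 - ν) ≤ x + α := by nlinarith
  calc x ^ ν = α ^ (ν - 1) * (x ^ ν * α ^ (1 - ν)) := by
        rw [mul_left_comm, hinv, mul_one]
    _ ≤ α ^ (ν - 1) * (x + α) := by gcongr

/-- For every ν ∈ [0,1] there is a constant `C_ν > 0` (depending only on ν
and T) such that for all α ∈ (0,1] and μ ∈ [0,α] one has `α‖Y_{α,μ}⁻¹ ∘ (T*T)^ν‖ ≤ C_ν α^ν`.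
Here `(T*T)^ν = Φ (x ↦ x^ν)` where `Φ` is the continuous functional calculus of the positive
selfadjoint operator `T*T`, characterized as a continuous unital star-algebra homomorphism
from `C([0, ‖T*T‖], ℝ)` sending the identity function to `T*T`. -/
theorem stmt15
    {Q V G X : Type*}
    [NormedAddCommGroup Q] [InnerProductSpace ℝ Q] [CompleteSpace Q]
    [NormedAddCommGroup V] [InnerProductSpace ℝ V] [CompleteSpace V]
    [NormedAddCommGroup G] [InnerProductSpace ℝ G] [CompleteSpace G]
    [NormedAddCommGroup X] [InnerProductSpace ℝ X] [CompleteSpace X]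
    (C' : V →L[ℝ] G) (L : Q →L[ℝ] X) (K : V →L[ℝ] X)
    (Kinv : X →L[ℝ] V)
    (hK₁ : ∀ v, Kinv (K v) = v) (hK₂ : ∀ x, K (Kinv x) = x)
    (T : WithLp 2 (Q × V) →L[ℝ] WithLp 2 (G × X))
    (hT : ∀ (q : Q) (u : V),
      WithLp.equiv 2 (G × X) (T ((WithLp.equiv 2 (Q × V)).symm (q, u))) = (C' u, L q + K u))
    (ν : ℝ) (hν : ν ∈ Set.Icc (0 : ℝ) 1)
    (Φ : C(Set.Icc (0 : ℝ) ‖T.adjoint ∘L T‖, ℝ)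
        →⋆ₐ[ℝ] (WithLp 2 (Q × V) →L[ℝ] WithLp 2 (Q × V)))
    (hΦcont : Continuous Φ)
    (hΦid : Φ (ContinuousMap.mk (fun x => (x : ℝ)) continuous_subtype_val)
      = T.adjoint ∘L T)
    (fpow : C(Set.Icc (0 : ℝ) ‖T.adjoint ∘L T‖, ℝ))
    (hfpow : ∀ x : Set.Icc (0 : ℝ) ‖T.adjoint ∘L T‖, fpow x = (x : ℝ) ^ ν)
    (P : WithLp 2 (Q × V) →L[ℝ] WithLp 2 (Q × V))
    (hP : P = Φ fpow) :
    ∃ Cν : ℝ, 0 < Cν ∧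
      ∀ (α μ : ℝ), 0 < α → α ≤ 1 → 0 ≤ μ → μ ≤ α →
        ∀ Y : WithLp 2 (Q × V) →L[ℝ] WithLp 2 (Q × V),
          (∀ x : WithLp 2 (Q × V),
            Y x = T.adjoint (T x)
              + (WithLp.equiv 2 (Q × V)).symm
                  (α • (WithLp.equiv 2 (Q × V) x).1, μ • (WithLp.equiv 2 (Q × V) x).2)) →
        ∀ Yinv : WithLp 2 (Q × V) →L[ℝ] WithLp 2 (Q × V),
          (∀ x, Yinv (Y x) = x) → (∀ x, Y (Yinv x) = x) →
          α * ‖Yinv ∘L P‖ ≤ Cν * α ^ ν := by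
  have hK : ∀ x : WithLp 2 (Q × V),
      ‖x.snd‖ ≤ ‖Kinv‖ * (‖T x‖ + ‖L‖ * ‖x.fst‖) := by
    intro x
    have h2 : (T x).snd = L x.fst + K x.snd := congrArg Prod.snd (hT x.fst x.snd)
    have hu : x.snd = Kinv ((T x).snd - L x.fst) := by
      rw [h2, add_sub_cancel_left, hK₁]
    have hTx : ‖(T x).snd‖ ≤ ‖T x‖ := by
      refine (sq_le_sq₀ (norm_nonneg _) (norm_nonneg _)).1 ?_
      rw [WithLp.prod_norm_sq_eq_of_L2 (T x)]
      nlinarith [sq_nonneg ‖(T x).fst‖]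
    calc ‖x.snd‖ = ‖Kinv ((T x).snd - L x.fst)‖ := by rw [← hu]
      _ ≤ ‖Kinv‖ * ‖(T x).snd - L x.fst‖ := Kinv.le_opNorm _
      _ ≤ ‖Kinv‖ * (‖T x‖ + ‖L‖ * ‖x.fst‖) := by
        gcongr
        exact (norm_sub_le _ _).trans (add_le_add hTx (L.le_opNorm _))
  obtain ⟨c, hc, hcoer⟩ : ∃ c : ℝ, 0 < c ∧
      ∀ x : WithLp 2 (Q × V), ‖x‖ ^ 2 ≤ c * (‖T x‖ ^ 2 + ‖x.fst‖ ^ 2) := by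
    refine ⟨1 + 2 * ‖Kinv‖ ^ 2 + 2 * ‖Kinv‖ ^ 2 * ‖L‖ ^ 2, by positivity, fun x => ?_⟩
    have h1 := pow_le_pow_left₀ (norm_nonneg _) (hK x) 2
    have h2 : (‖T x‖ + ‖L‖ * ‖x.fst‖) ^ 2 ≤ 2 * (‖T x‖ ^ 2 + ‖L‖ ^ 2 * ‖x.fst‖ ^ 2) := by
      nlinarith [sq_nonneg (‖T x‖ - ‖L‖ * ‖x.fst‖)]
    have h3 := mul_le_mul_of_nonneg_left h2 (sq_nonneg ‖Kinv‖)
    rw [mul_pow] at h1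
    rw [WithLp.prod_norm_sq_eq_of_L2 x]
    have e1 : 0 ≤ ‖Kinv‖ ^ 2 * ‖x.fst‖ ^ 2 := by positivity
    have e2 : 0 ≤ ‖Kinv‖ ^ 2 * ‖L‖ ^ 2 * ‖T x‖ ^ 2 := by positivity
    have e3 : 0 ≤ ‖T x‖ ^ 2 := by positivity
    linarith
  refine ⟨1 + c, by positivity, fun α μ hα hα1 hμ hμα Y hY Yinv hY₁ hY₂ => ?_⟩
  have hYinv : ∀ z, α * ‖Yinv z‖ ≤ c * ‖z‖ := by
    intro z
    set w := Yinv z with hw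
    have hin : inner ℝ (Y w) w = ‖T w‖ ^ 2 + (α * ‖w.fst‖ ^ 2 + μ * ‖w.snd‖ ^ 2) := by
      rw [hY, inner_add_left, ContinuousLinearMap.adjoint_inner_left, real_inner_self_eq_norm_sq,
        WithLp.prod_inner_apply]
      congr 1
      change inner ℝ (α • w.fst) w.fst + inner ℝ (μ • w.snd) w.snd = _
      rw [real_inner_smul_left, real_inner_smul_left, real_inner_self_eq_norm_sq,
        real_inner_self_eq_norm_sq]
    rw [hY₂] at hin
    have hle := real_inner_le_norm z w
    have h1 : α * (‖T w‖ ^ 2 + ‖w.fst‖ ^ 2) ≤ ‖z‖ * ‖w‖ := by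
      have := mul_nonneg hμ (sq_nonneg ‖w.snd‖)
      have := mul_le_mul_of_nonneg_right hα1 (sq_nonneg ‖T w‖)
      linarith
    have h2 : α * ‖w‖ * ‖w‖ ≤ c * ‖z‖ * ‖w‖ := by
      have h3 := mul_le_mul_of_nonneg_left (hcoer w) hα.le
      have h4 := mul_le_mul_of_nonneg_left h1 hc.le
      linarith
    rcases (norm_nonneg w).eq_or_lt with h0 | h0
    · rw [← h0, mul_zero]; positivity
    · exact le_of_mul_le_mul_right h2 h0
  have hresolvent : ∀ x, ‖Yinv (T.adjoint (T x) + α • x)‖ ≤ (1 + c) * ‖x‖ := by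
    intro x
    let d : WithLp 2 (Q × V) := (WithLp.equiv 2 (Q × V)).symm (0, (α - μ) • x.snd)
    have hsplit : T.adjoint (T x) + α • x = Y x + d := by
      rw [hY, add_assoc]
      congr 1
      apply (WithLp.equiv 2 (Q × V)).injective
      refine Prod.ext ?_ ?_
      · change α • x.fst = α • x.fst + 0
        rw [add_zero]
      · change α • x.snd = μ • x.snd + (α - μ) • x.snd
        rw [← add_smul, add_sub_cancel]
    have hd : ‖d‖ ≤ α * ‖x‖ := by
      refine (sq_le_sq₀ (norm_nonneg _) (by positivity)).1 ?_
      rw [mul_pow, WithLp.prod_norm_sq_eq_of_L2 d, WithLp.prod_norm_sq_eq_of_L2 x]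
      change ‖(0 : Q)‖ ^ 2 + ‖(α - μ) • x.snd‖ ^ 2 ≤ _
      rw [norm_smul, Real.norm_of_nonneg (sub_nonneg.mpr hμα), norm_zero, mul_pow]
      have h1 : (α - μ) ^ 2 ≤ α ^ 2 := by
        apply pow_le_pow_left₀ (sub_nonneg.mpr hμα); linarith
      have h2 := mul_le_mul_of_nonneg_right h1 (sq_nonneg ‖x.snd‖)
      have h3 : 0 ≤ α ^ 2 * ‖x.fst‖ ^ 2 := by positivity
      linarith
    have hYd : ‖Yinv d‖ ≤ c * ‖x‖ := by
      refine le_of_mul_le_mul_left ?_ hα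
      have := mul_le_mul_of_nonneg_left hd hc.le
      linarith [hYinv d]
    rw [hsplit, map_add, hY₁]
    linarith [norm_add_le x (Yinv d)]
  let g : C(Set.Icc (0 : ℝ) ‖T.adjoint ∘L T‖, ℝ) :=
    ⟨fun x => fpow x / ((x : ℝ) + α), fpow.continuous.div (by fun_prop)
      fun x => (add_pos_of_nonneg_of_pos x.2.1 hα).ne'⟩
  have hg : ∀ s, |g s| ≤ α ^ (ν - 1) := by
    intro s
    have hs : 0 ≤ (s : ℝ) := s.2.1
    change |fpow s / ((s : ℝ) + α)| ≤ _
    rw [hfpow, abs_of_nonneg (by positivity)]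
    exact Real.rpow_div_add_le_rpow_sub_one hs hα hν.1 hν.2
  have hfac : P = (T.adjoint ∘L T + α • 1) * Φ g := by
    refine hP.trans (starAlgHom_apply_eq_add_smul_one_mul Φ hΦid ?_)
    ext s
    have hs : (s : ℝ) + α ≠ 0 := (add_pos_of_nonneg_of_pos s.2.1 hα).ne'
    simp only [g, ContinuousMap.mul_apply, ContinuousMap.add_apply, ContinuousMap.coe_mk,
      ContinuousMap.smul_apply, ContinuousMap.one_apply, smul_eq_mul, mul_one]
    field_simp
  have hbound : ‖Yinv ∘L P‖ ≤ (1 + c) * α ^ (ν - 1) := by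
    refine ContinuousLinearMap.opNorm_le_bound _ (by positivity) fun x => ?_
    have hPx : P x = T.adjoint (T (Φ g x)) + α • Φ g x := by
      rw [hfac]
      rfl
    rw [ContinuousLinearMap.comp_apply, hPx, mul_assoc]
    refine (hresolvent _).trans ?_
    gcongr
    exact norm_starAlgHom_apply_le_of_abs_le Φ g (by positivity) hg x
  calc α * ‖Yinv ∘L P‖ ≤ α * ((1 + c) * α ^ (ν - 1)) := by gcongr
    _ = (1 + c) * α ^ ν := by
      rw [Real.rpow_sub_one hα.ne']
      field_simp
end

section
/- Let A : Q × V → X and C : V → G be maps, q₀, q_old, q† ∈ Q, u₀, u_old, u† ∈ V, g, g^δ ∈ G, f ∈ X, δ ≥ 0 with ‖g − g^δ‖_G ≤ δ, C(u†) = g, A(q†, u†) = f. Let C̃ : V → G, L : Q → X, K : V → X be bounded linear operators satisfying the tangential cone conditions ‖C(u_old) − C(u†) − C̃(u_old − u†)‖_G ≤ c ‖C(u_old) − C(u†)‖_G and ‖A(q_old, u_old) − A(q†, u†) − L(q_old − q†) − K(u_old − u†)‖_X ≤ 4c² ‖A(q_old, u_old) − A(q†, u†)‖_X for some c ≥ 0.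 Let β > 0 and suppose (q, u) ∈ Q × V and p ∈ X satisfy: for all δq ∈ Q, δu ∈ V, ⟨C̃(u − u_old) + C(u_old) − g^δ, C̃ δu⟩_G + (1/β)(⟨q − q₀, δq⟩_Q + ⟨u − u₀, δu⟩_V) + (1/2)⟨L δq + K δu, p⟩_X = 0, and L(q − q_old) + K(u − u_old) + A(q_old, u_old) − f = 0. Set I₂ := ‖C̃(u − u_old) + C(u_old) − g^δ‖_G² and I₃ := ‖C(u_old) − g^δ‖_G² + ϱ ‖A(q_old, u_old) − f‖_X where ϱ ≥ ‖p‖_X. If τ > 0, δ² ≤ I₃/τ², and θ I₃ ≤ I₂ for some θ ≥ 2(2c² + (1 + 2c²)/τ²), then ‖q − q₀‖_Q² + ‖u − u₀‖_V² ≤ ‖q† − q₀‖_Q² + ‖u† − u₀‖_V². -/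
open scoped RealInnerProductSpace

/-- Young's inequality for the inner product of `x` with a perturbation of itself. -/
lemma norm_sq_sub_norm_sq_le_two_mul_inner_sub {E : Type*} [NormedAddCommGroup E]
    [InnerProductSpace ℝ E] (x y : E) : ‖x‖ ^ 2 - ‖y‖ ^ 2 ≤ 2 * ⟪x, x - y⟫ := by
  have h := norm_sub_sq_real x y
  rw [inner_sub_right, real_inner_self_eq_norm_sq]
  nlinarith [sq_nonneg ‖x - y‖]

/-- Monotonicity of the iteration error: under the tangential cone
conditions, the stationarity system of the Gauss-Newton step, the discrepancy-type lower
bound `θ I₃ ≤ I₂` and `δ² ≤ I₃/τ²`, the new iterate is at least as close to the exact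
solution (in the shifted norm) as the exact solution is to the initial guess. -/
theorem stmt17
    {Q V G X : Type*}
    [NormedAddCommGroup Q] [InnerProductSpace ℝ Q] [CompleteSpace Q]
    [NormedAddCommGroup V] [InnerProductSpace ℝ V] [CompleteSpace V]
    [NormedAddCommGroup G] [InnerProductSpace ℝ G] [CompleteSpace G]
    [NormedAddCommGroup X] [InnerProductSpace ℝ X] [CompleteSpace X]
    (A : Q × V → X) (C : V → G)
    (q₀ qold qd : Q) (u₀ uold ud : V)
    (g gδ : G) (f : X) (δ : ℝ) (hδ : 0 ≤ δ)
    (hnoise : ‖g - gδ‖ ≤ δ) (hCd : C ud = g) (hAd : A (qd, ud) = f)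
    (C' : V →L[ℝ] G) (L : Q →L[ℝ] X) (K : V →L[ℝ] X)
    (c : ℝ) (hc : 0 ≤ c)
    (htcC : ‖C uold - C ud - C' (uold - ud)‖ ≤ c * ‖C uold - C ud‖)
    (htcA : ‖A (qold, uold) - A (qd, ud) - L (qold - qd) - K (uold - ud)‖
      ≤ 4 * c ^ 2 * ‖A (qold, uold) - A (qd, ud)‖)
    (β : ℝ) (hβ : 0 < β)
    (q : Q) (u : V) (p : X)
    (hstat : ∀ (δq : Q) (δu : V),
      ⟪C' (u - uold) + C uold - gδ, C' δu⟫
        + (1 / β) * (⟪q - q₀, δq⟫ + ⟪u - u₀, δu⟫)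
        + (1 / 2) * ⟪L δq + K δu, p⟫ = 0)
    (hconstr : L (q - qold) + K (u - uold) + A (qold, uold) - f = 0)
    (ϱ : ℝ) (hϱ : ‖p‖ ≤ ϱ)
    (τ θ : ℝ) (hτ : 0 < τ)
    (hδI₃ : δ ^ 2 ≤ (‖C uold - gδ‖ ^ 2 + ϱ * ‖A (qold, uold) - f‖) / τ ^ 2)
    (hθ : 2 * (2 * c ^ 2 + (1 + 2 * c ^ 2) / τ ^ 2) ≤ θ)
    (hdiscr : θ * (‖C uold - gδ‖ ^ 2 + ϱ * ‖A (qold, uold) - f‖)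
      ≤ ‖C' (u - uold) + C uold - gδ‖ ^ 2) :
    ‖q - q₀‖ ^ 2 + ‖u - u₀‖ ^ 2 ≤ ‖qd - q₀‖ ^ 2 + ‖ud - u₀‖ ^ 2 := by
  subst hCd hAd
  set a := ‖C uold - gδ‖ with ha
  set b := ‖A (qold, uold) - A (qd, ud)‖ with hb
  set I₃ := a ^ 2 + ϱ * b with hI₃
  set r := C' (u - uold) + C uold - gδ with hr
  set s := C uold - C ud - C' (uold - ud) + (C ud - gδ) with hs
  set w := A (qold, uold) - A (qd, ud) - L (qold - qd) - K (uold - ud) with hw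
  have hb0 : 0 ≤ b := norm_nonneg _
  have hI₃0 : 0 ≤ I₃ := by
    have := mul_nonneg ((norm_nonneg p).trans hϱ) hb0
    positivity
  have hCr : C' (u - ud) = r - s := by
    simp only [hr, hs, map_sub]; abel
  have hLw : L (q - qd) + K (u - ud) = -w := by
    rw [← sub_eq_zero, ← hconstr]
    simp only [hw, map_sub]; abel
  have hs_sq : ‖s‖ ^ 2 ≤ 4 * c ^ 2 * a ^ 2 + (2 + 4 * c ^ 2) * δ ^ 2 := by
    have htri : ‖C uold - C ud‖ ≤ a + δ := by
      calc ‖C uold - C ud‖ = ‖(C uold - gδ) - (C ud - gδ)‖ := by congr 1; abel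
        _ ≤ a + ‖C ud - gδ‖ := norm_sub_le _ _
        _ ≤ a + δ := by gcongr
    have hs_le : ‖s‖ ≤ c * (a + δ) + δ :=
      (norm_add_le _ _).trans
        (add_le_add (htcC.trans (mul_le_mul_of_nonneg_left htri hc)) hnoise)
    calc ‖s‖ ^ 2 ≤ (c * (a + δ) + δ) ^ 2 := by gcongr
      _ ≤ _ := by
        nlinarith [sq_nonneg (c * (a + δ) - δ), sq_nonneg (c * (a - δ))]
  have hwp : ⟪w, p⟫ ≤ 4 * c ^ 2 * (ϱ * b) := by
    calc ⟪w, p⟫ ≤ ‖w‖ * ‖p‖ := real_inner_le_norm _ _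
      _ ≤ (4 * c ^ 2 * b) * ϱ := by gcongr
      _ = _ := by ring
  have hδ' : (1 + 2 * c ^ 2) * δ ^ 2 ≤ (1 + 2 * c ^ 2) / τ ^ 2 * I₃ := by
    calc (1 + 2 * c ^ 2) * δ ^ 2 ≤ (1 + 2 * c ^ 2) * (I₃ / τ ^ 2) := by gcongr
      _ = _ := by ring
  have hθ' := mul_le_mul_of_nonneg_right hθ hI₃0
  have hrs := norm_sq_sub_norm_sq_le_two_mul_inner_sub r s
  have hst := hstat (q - qd) (u - ud)
  rw [hCr, hLw, inner_neg_left] at hst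
  have hβin : (1 / β) * (⟪q - q₀, q - qd⟫ + ⟪u - u₀, u - ud⟫) ≤ 0 := by
    have hcI : 4 * c ^ 2 * I₃ = 4 * c ^ 2 * a ^ 2 + 4 * c ^ 2 * (ϱ * b) := by
      rw [hI₃]; ring
    linarith
  have hin : ⟪q - q₀, q - qd⟫ + ⟪u - u₀, u - ud⟫ ≤ 0 :=
    nonpos_of_mul_nonpos_right hβin (by positivity)
  have hq := norm_sq_sub_norm_sq_le_two_mul_inner_sub (q - q₀) (qd - q₀)
  have hu := norm_sq_sub_norm_sq_le_two_mul_inner_sub (u - u₀) (ud - u₀)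
  rw [sub_sub_sub_cancel_right] at hq hu
  linarith
end
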